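/- arXiv:2209.15562 — 5 statements merged into one kernel-verified Lean document; each statement's English description precedes it below -/
import Mathlib

section
/- Let n, m be positive integers, Φ ∈ ℝ^{n×m}, A ∈ ℝ^{m×m}, and let M > 0 and γ > 0 satisfy ‖A‖ ≤ M and γ₀ := γM < 1, where ‖·‖ denotes the ℓ2 operator norm. Then the implicit-layer map T(Z) = relu(γ·Z·A + Φ) on ℝ^{n×m} is a γ₀-contraction in the Frobenius norm: for all Z₁, Z₂ ∈ ℝ^{n×m}, ‖relu(γ·Z₁·A + Φ) − relu(γ·Z₂·A + Φ)‖_F ≤ γ₀·‖Z₁ − Z₂‖_F. -/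
open Matrix
open scoped Kronecker

/-- The ℓ2 operator norm of a real matrix. -/
noncomputable def l2OpNorm {ι κ : Type*} [Fintype ι] [Fintype κ] [DecidableEq κ]
    (A : Matrix ι κ ℝ) : ℝ :=
  ‖LinearMap.toContinuousLinearMap (Matrix.toEuclideanLin A)‖

/-- The Frobenius norm of a real matrix. -/
noncomputable def frobNorm {ι κ : Type*} [Fintype ι] [Fintype κ] (A : Matrix ι κ ℝ) : ℝ :=
  Real.sqrt (∑ i, ∑ j, (A i j) ^ 2)

/-- Entrywise ReLU applied to a real matrix. -/
noncomputable def reluM {ι κ : Type*} (A : Matrix ι κ ℝ) : Matrix ι κ ℝ :=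
  Matrix.of fun i j => max (A i j) 0

open scoped Matrix.Norms.L2Operator in
lemma row_bound {m : ℕ} (A : Matrix (Fin m) (Fin m) ℝ) (M : ℝ) (hAM : l2OpNorm A ≤ M)
    (z : Fin m → ℝ) : ∑ j, ((z ᵥ* A) j) ^ 2 ≤ M ^ 2 * ∑ j, (z j) ^ 2 := by
  have hA : ‖Aᴴ‖ ≤ M := by
    rw [Matrix.l2_opNorm_conjTranspose]
    exact hAM
  have h := Matrix.l2_opNorm_mulVec Aᴴ (WithLp.toLp 2 z)
  have h2 := h.trans (mul_le_mul_of_nonneg_right hA (norm_nonneg _))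
  have h3 := pow_le_pow_left₀ (norm_nonneg _) h2 2
  rw [mul_pow, EuclideanSpace.norm_sq_eq, EuclideanSpace.norm_sq_eq] at h3
  simpa [Matrix.conjTranspose_eq_transpose_of_trivial, Matrix.mulVec_transpose] using h3

lemma relu_sq (a b : ℝ) : (max a 0 - max b 0) ^ 2 ≤ (a - b) ^ 2 :=
  sq_le_sq.2 (abs_max_sub_max_le_abs a b 0)

/-- The implicit-layer map `T(Z) = relu(γ·Z·A + Φ)` is a `γ·M`-contraction in the
Frobenius norm whenever `‖A‖ ≤ M` and `γ·M < 1`. -/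
theorem implicit_layer_contraction (n m : ℕ) (hn : 0 < n) (hm : 0 < m)
    (Φ : Matrix (Fin n) (Fin m) ℝ) (A : Matrix (Fin m) (Fin m) ℝ)
    (M γ : ℝ) (hM : 0 < M) (hγ : 0 < γ)
    (hAM : l2OpNorm A ≤ M) (hγ0 : γ * M < 1) :
    ∀ Z₁ Z₂ : Matrix (Fin n) (Fin m) ℝ,
      frobNorm (reluM (γ • (Z₁ * A) + Φ) - reluM (γ • (Z₂ * A) + Φ)) ≤
        (γ * M) * frobNorm (Z₁ - Z₂) := by
  intro Z₁ Z₂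
  have hc : 0 ≤ γ * M := by positivity
  unfold frobNorm
  refine Real.sqrt_le_iff.2 ⟨by positivity, ?_⟩
  rw [mul_pow, Real.sq_sqrt (by positivity), Finset.mul_sum]
  refine Finset.sum_le_sum fun i _ => ?_
  have hb := row_bound A M hAM ((Z₁ - Z₂) i)
  have hr : ∑ j, ((reluM (γ • (Z₁ * A) + Φ) - reluM (γ • (Z₂ * A) + Φ)) i j) ^ 2
      ≤ ∑ j, γ ^ 2 * ((((Z₁ - Z₂) i) ᵥ* A) j) ^ 2 := by
    refine Finset.sum_le_sum fun j _ => ?_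
    have e : (((Z₁ - Z₂) i) ᵥ* A) j = (Z₁ * A) i j - (Z₂ * A) i j := by
      rw [← Matrix.sub_apply, ← Matrix.sub_mul]
      rfl
    rw [e]
    refine (relu_sq _ _).trans (le_of_eq ?_)
    simp only [Matrix.add_apply, Matrix.smul_apply, smul_eq_mul]
    ring
  refine hr.trans ?_
  rw [← Finset.mul_sum, mul_pow, mul_assoc]
  exact mul_le_mul_of_nonneg_left hb (sq_nonneg γ)
end

section
/- Let n, m be positive integers, Φ ∈ ℝ^{n×m}, A ∈ ℝ^{m×m}, and let M > 0 and γ > 0 satisfy ‖A‖ ≤ M and γ₀ := γM < 1. Then there exists a unique Z ∈ ℝ^{n×m} with Z = relu(γ·Z·A + Φ); that is, the equilibrium point of the implicit-layer map is uniquely determined. -/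
open Matrix
open scoped Kronecker

open scoped Matrix.Norms.L2Operator in
lemma vecMul_norm_le {m : ℕ} (A : Matrix (Fin m) (Fin m) ℝ) (x : Fin m → ℝ) :
    ‖WithLp.toLp 2 (x ᵥ* A)‖ ≤ l2OpNorm A * ‖WithLp.toLp 2 x‖ := by
  have h := Matrix.l2_opNorm_mulVec Aᴴ (WithLp.toLp 2 x)
  rw [Matrix.l2_opNorm_conjTranspose, Matrix.conjTranspose_eq_transpose_of_trivial,
    Matrix.mulVec_transpose] at h
  exact h

/-- The layer map acting on one row. -/
noncomputable def rowMap {m : ℕ} (A : Matrix (Fin m) (Fin m) ℝ) (γ : ℝ) (φ : Fin m → ℝ)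
    (x : EuclideanSpace ℝ (Fin m)) : EuclideanSpace ℝ (Fin m) :=
  WithLp.toLp 2 fun j => max (γ * (x.ofLp ᵥ* A) j + φ j) 0

lemma rowMap_dist {m : ℕ} (A : Matrix (Fin m) (Fin m) ℝ) (M γ : ℝ) (hγ : 0 < γ)
    (hAM : l2OpNorm A ≤ M) (φ : Fin m → ℝ) (x y : EuclideanSpace ℝ (Fin m)) :
    dist (rowMap A γ φ x) (rowMap A γ φ y) ≤ γ * M * dist x y := by
  have h1 : dist (rowMap A γ φ x) (rowMap A γ φ y)
      ≤ ‖γ • WithLp.toLp 2 ((x - y).ofLp ᵥ* A)‖ := by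
    rw [EuclideanSpace.dist_eq, EuclideanSpace.norm_eq]
    apply Real.sqrt_le_sqrt
    refine Finset.sum_le_sum fun j _ => ?_
    refine pow_le_pow_left₀ dist_nonneg ?_ 2
    have h := abs_max_sub_max_le_abs (γ * (x.ofLp ᵥ* A) j + φ j) (γ * (y.ofLp ᵥ* A) j + φ j) 0
    rw [Real.dist_eq]
    refine h.trans (le_of_eq ?_)
    simp only [WithLp.ofLp_sub, Matrix.sub_vecMul, PiLp.smul_apply, Pi.sub_apply, smul_eq_mul,
      Real.norm_eq_abs]
    congr 1
    ring
  rw [norm_smul, Real.norm_eq_abs, abs_of_pos hγ] at h1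
  have h2 := vecMul_norm_le A (x - y).ofLp
  have h3 : l2OpNorm A * ‖x - y‖ ≤ M * ‖x - y‖ :=
    mul_le_mul_of_nonneg_right hAM (norm_nonneg _)
  rw [dist_eq_norm x y, mul_assoc]
  exact h1.trans (mul_le_mul_of_nonneg_left (h2.trans h3) hγ.le)

lemma rowMap_existsUnique {m : ℕ} (A : Matrix (Fin m) (Fin m) ℝ) (M γ : ℝ) (hM : 0 < M)
    (hγ : 0 < γ) (hAM : l2OpNorm A ≤ M) (hγ0 : γ * M < 1) (φ : Fin m → ℝ) :
    ∃! x, rowMap A γ φ x = x := by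
  have hc : ContractingWith ⟨γ * M, by positivity⟩ (rowMap A γ φ) := by
    refine ⟨?_, LipschitzWith.of_dist_le_mul fun x y => rowMap_dist A M γ hγ hAM φ x y⟩
    exact_mod_cast hγ0
  exact ⟨_, hc.fixedPoint_isFixedPt, fun y hy => hc.fixedPoint_unique hy⟩

/-- If `‖A‖ ≤ M` and `γ·M < 1`, the implicit-layer map `T(Z) = relu(γ·Z·A + Φ)`
has a unique equilibrium point (fixed point). -/
theorem implicit_layer_unique_equilibrium (n m : ℕ) (hn : 0 < n) (hm : 0 < m)
    (Φ : Matrix (Fin n) (Fin m) ℝ) (A : Matrix (Fin m) (Fin m) ℝ)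
    (M γ : ℝ) (hM : 0 < M) (hγ : 0 < γ)
    (hAM : l2OpNorm A ≤ M) (hγ0 : γ * M < 1) :
    ∃! Z : Matrix (Fin n) (Fin m) ℝ, Z = reluM (γ • (Z * A) + Φ) := by
  choose z hz hu using fun i => rowMap_existsUnique A M γ hM hγ hAM hγ0 (Φ i)
  refine ⟨Matrix.of fun i => (z i).ofLp, ?_, fun Y hY => ?_⟩
  · ext i j
    have := congrArg (fun v : EuclideanSpace ℝ (Fin m) => v.ofLp j) (hz i)
    exact this.symm
  · ext i j
    have := hu i (WithLp.toLp 2 (Y i)) (by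
      ext k
      exact (congrFun (congrFun hY i) k).symm)
    exact congrArg (fun v : EuclideanSpace ℝ (Fin m) => v.ofLp j) this
end

section
/- Let n, m be positive integers, Φ ∈ ℝ^{n×m}, A ∈ ℝ^{m×m}, and let M > 0 and γ > 0 satisfy ‖A‖ ≤ M and γ₀ := γM < 1. Define the forward-iteration sequence Z⁰ = 0 and Z^ℓ = relu(γ·Z^{ℓ−1}·A + Φ) for ℓ ≥ 1. Then ‖Z^ℓ‖_F ≤ ‖Φ‖_F / (1 − γ₀) for every ℓ, and the sequence (Z^ℓ) converges to the unique fixed point Z of the map Z ↦ relu(γ·Z·A + Φ). -/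
open Matrix
open scoped Kronecker

section FrobHelpers

attribute [local instance] Matrix.frobeniusNormedAddCommGroup Matrix.frobeniusNormedSpace

theorem frobNorm_eq_norm {n m : ℕ} (B : Matrix (Fin n) (Fin m) ℝ) : frobNorm B = ‖B‖ := by
  rw [Matrix.frobenius_norm_def, frobNorm, Real.sqrt_eq_rpow]
  simp

theorem frobNorm_mono {n m : ℕ} (B C : Matrix (Fin n) (Fin m) ℝ)
    (h : ∀ i j, |B i j| ≤ |C i j|) : frobNorm B ≤ frobNorm C := by
  unfold frobNorm
  apply Real.sqrt_le_sqrt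
  exact Finset.sum_le_sum fun i _ => Finset.sum_le_sum fun j _ => sq_le_sq.mpr (h i j)

theorem l2OpNorm_transpose_eq {m : ℕ} (A : Matrix (Fin m) (Fin m) ℝ) :
    l2OpNorm Aᵀ = l2OpNorm A := by
  have h := Matrix.l2_opNorm_conjTranspose A
  rw [Matrix.l2_opNorm_def, Matrix.l2_opNorm_def, Matrix.conjTranspose_eq_transpose_of_trivial] at h
  exact h

theorem frobNorm_mul_le {n m : ℕ} (B : Matrix (Fin n) (Fin m) ℝ) (A : Matrix (Fin m) (Fin m) ℝ) :
    frobNorm (B * A) ≤ l2OpNorm A * frobNorm B := by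
  have h0 : 0 ≤ l2OpNorm A := norm_nonneg _
  unfold frobNorm
  apply Real.sqrt_le_iff.mpr
  refine ⟨by positivity, ?_⟩
  rw [mul_pow, Real.sq_sqrt (by positivity), Finset.mul_sum]
  refine Finset.sum_le_sum fun i _ => ?_
  have key := (LinearMap.toContinuousLinearMap (Matrix.toEuclideanLin Aᵀ)).le_opNorm
    (WithLp.toLp 2 (B i))
  change _ ≤ l2OpNorm Aᵀ * _ at key
  rw [l2OpNorm_transpose_eq] at key
  have k2 := pow_le_pow_left₀ (norm_nonneg _) key 2
  rw [mul_pow, EuclideanSpace.norm_sq_eq, EuclideanSpace.norm_sq_eq] at k2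
  simpa [Matrix.toLpLin_apply, Matrix.mulVec_transpose, Matrix.mul_apply_eq_vecMul] using k2

theorem frobNorm_step_le {n m : ℕ} (Φ : Matrix (Fin n) (Fin m) ℝ) (A : Matrix (Fin m) (Fin m) ℝ)
    (M γ : ℝ) (hγ : 0 < γ) (hAM : l2OpNorm A ≤ M) (Z W : Matrix (Fin n) (Fin m) ℝ) :
    ‖reluM (γ • (Z * A) + Φ) - reluM (γ • (W * A) + Φ)‖ ≤ γ * M * ‖Z - W‖ := by
  calc ‖reluM (γ • (Z * A) + Φ) - reluM (γ • (W * A) + Φ)‖ ≤ ‖γ • ((Z - W) * A)‖ := by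
        rw [← frobNorm_eq_norm, ← frobNorm_eq_norm]
        apply frobNorm_mono
        intro i j
        have := abs_max_sub_max_le_abs ((γ • (Z * A) + Φ) i j) ((γ • (W * A) + Φ) i j) 0
        refine this.trans (le_of_eq ?_)
        congr 1
        simp [Matrix.sub_mul]
        ring
    _ = γ * ‖(Z - W) * A‖ := by rw [norm_smul, Real.norm_of_nonneg hγ.le]
    _ ≤ γ * (M * ‖Z - W‖) := by
        gcongr
        rw [← frobNorm_eq_norm, ← frobNorm_eq_norm]
        refine (frobNorm_mul_le _ _).trans ?_
        gcongr
        exact Real.sqrt_nonneg _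
    _ = _ := by ring

theorem reluM_zero_step_le {n m : ℕ} (Φ : Matrix (Fin n) (Fin m) ℝ) : ‖reluM Φ‖ ≤ ‖Φ‖ := by
  rw [← frobNorm_eq_norm, ← frobNorm_eq_norm]
  apply frobNorm_mono
  intro i j
  simpa [reluM] using abs_max_sub_max_le_abs (Φ i j) 0 0

theorem forward_aux (n m : ℕ)
    (Φ : Matrix (Fin n) (Fin m) ℝ) (A : Matrix (Fin m) (Fin m) ℝ)
    (M γ : ℝ) (hM : 0 < M) (hγ : 0 < γ)
    (hAM : l2OpNorm A ≤ M) (hγ0 : γ * M < 1)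
    (Zseq : ℕ → Matrix (Fin n) (Fin m) ℝ)
    (hZ0 : Zseq 0 = 0)
    (hZrec : ∀ ℓ : ℕ, Zseq (ℓ + 1) = reluM (γ • (Zseq ℓ * A) + Φ)) :
    (∀ ℓ : ℕ, frobNorm (Zseq ℓ) ≤ frobNorm Φ / (1 - γ * M)) ∧
    ∃ Z : Matrix (Fin n) (Fin m) ℝ,
      Z = reluM (γ • (Z * A) + Φ) ∧
      (∀ W : Matrix (Fin n) (Fin m) ℝ, W = reluM (γ • (W * A) + Φ) → W = Z) ∧
      Filter.Tendsto (fun l => ‖Zseq l - Z‖) Filter.atTop (nhds 0) := by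
  have hstep := frobNorm_step_le Φ A M γ hγ hAM
  have hpos : 0 < 1 - γ * M := by linarith
  constructor
  · intro l
    rw [frobNorm_eq_norm, frobNorm_eq_norm, le_div_iff₀ hpos]
    induction l with
    | zero => rw [hZ0, norm_zero, zero_mul]; exact norm_nonneg _
    | succ l ih =>
      have h1 := hstep (Zseq l) 0
      rw [← hZrec, sub_zero, Matrix.zero_mul, smul_zero, zero_add] at h1
      have h2 := norm_sub_norm_le (Zseq (l + 1)) (reluM Φ)
      have h3 := reluM_zero_step_le Φ
      have h4 : ‖Zseq (l + 1)‖ ≤ γ * M * ‖Zseq l‖ + ‖Φ‖ := by linarith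
      have h5 : 0 < γ * M := by positivity
      nlinarith
  · haveI : CompleteSpace (Matrix (Fin n) (Fin m) ℝ) := FiniteDimensional.complete ℝ _
    let T : Matrix (Fin n) (Fin m) ℝ → Matrix (Fin n) (Fin m) ℝ :=
      fun Z => reluM (γ • (Z * A) + Φ)
    have hT : ContractingWith ⟨γ * M, by positivity⟩ T := by
      refine ⟨hγ0, LipschitzWith.of_dist_le_mul fun Z W => ?_⟩
      rw [dist_eq_norm, dist_eq_norm]
      exact hstep Z W
    refine ⟨hT.fixedPoint, hT.fixedPoint_isFixedPt.symm, fun W hW => hT.fixedPoint_unique hW.symm, ?_⟩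
    have ht := hT.tendsto_iterate_fixedPoint 0
    have he : ∀ l, T^[l] 0 = Zseq l := by
      intro l
      induction l with
      | zero => exact hZ0.symm
      | succ l ih => rw [Function.iterate_succ_apply', ih, hZrec]
    simp_rw [he] at ht
    exact tendsto_iff_norm_sub_tendsto_zero.mp ht

theorem entry_le_norm {n m : ℕ} (B : Matrix (Fin n) (Fin m) ℝ) (i : Fin n) (j : Fin m) :
    |B i j| ≤ ‖B‖ := by
  rw [← frobNorm_eq_norm]
  apply Real.abs_le_sqrt
  exact (Finset.single_le_sum (f := fun j => B i j ^ 2) (fun _ _ => sq_nonneg _)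
      (Finset.mem_univ j)).trans
    (Finset.single_le_sum (f := fun i => ∑ j, B i j ^ 2)
      (fun _ _ => Finset.sum_nonneg fun _ _ => sq_nonneg _) (Finset.mem_univ i))

theorem tendsto_entry {n m : ℕ} (Zs : ℕ → Matrix (Fin n) (Fin m) ℝ) (Z : Matrix (Fin n) (Fin m) ℝ)
    (h : Filter.Tendsto (fun l => ‖Zs l - Z‖) Filter.atTop (nhds 0)) (i : Fin n) (j : Fin m) :
    Filter.Tendsto (fun l => Zs l i j) Filter.atTop (nhds (Z i j)) := by
  rw [tendsto_iff_norm_sub_tendsto_zero]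
  exact squeeze_zero (fun _ => norm_nonneg _) (fun l => entry_le_norm (Zs l - Z) i j) h

end FrobHelpers

/-- The forward iteration `Z⁰ = 0`, `Z^{ℓ} = relu(γ·Z^{ℓ−1}·A + Φ)` stays bounded by
`‖Φ‖_F/(1−γM)` in Frobenius norm and converges to the unique fixed point of the
implicit-layer map. -/
theorem forward_iteration_bounded_and_converges (n m : ℕ) (hn : 0 < n) (hm : 0 < m)
    (Φ : Matrix (Fin n) (Fin m) ℝ) (A : Matrix (Fin m) (Fin m) ℝ)
    (M γ : ℝ) (hM : 0 < M) (hγ : 0 < γ)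
    (hAM : l2OpNorm A ≤ M) (hγ0 : γ * M < 1)
    (Zseq : ℕ → Matrix (Fin n) (Fin m) ℝ)
    (hZ0 : Zseq 0 = 0)
    (hZrec : ∀ ℓ : ℕ, Zseq (ℓ + 1) = reluM (γ • (Zseq ℓ * A) + Φ)) :
    (∀ ℓ : ℕ, frobNorm (Zseq ℓ) ≤ frobNorm Φ / (1 - γ * M)) ∧
    ∃ Z : Matrix (Fin n) (Fin m) ℝ,
      Z = reluM (γ • (Z * A) + Φ) ∧
      (∀ W : Matrix (Fin n) (Fin m) ℝ, W = reluM (γ • (W * A) + Φ) → W = Z) ∧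
      Filter.Tendsto Zseq Filter.atTop (nhds Z) := by
  obtain ⟨h1, Z, h2, h3, h4⟩ := forward_aux n m Φ A M γ hM hγ hAM hγ0 Zseq hZ0 hZrec
  refine ⟨h1, Z, h2, h3, ?_⟩
  exact tendsto_pi_nhds.mpr fun i => tendsto_pi_nhds.mpr fun j => tendsto_entry Zseq Z h4 i j
end

section
/- Let n, m be positive integers, let Φ ∈ ℝ^{n×m} and A ∈ ℝ^{m×m} have all entries nonnegative, and let γ > 0 satisfy γ‖A‖ < 1. Then Z := Φ·(I_m − γA)^{−1} has all entries nonnegative and satisfies relu(γ·Z·A + Φ) = Z; in particular Z is the unique equilibrium point of the implicit-layer map, and the ReLU acts as the identity at this equilibrium. -/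
open Matrix
open scoped Kronecker

open scoped Matrix.Norms.L2Operator in
theorem neumann_aux {m : ℕ} (B : Matrix (Fin m) (Fin m) ℝ) (hB : ∀ i j, 0 ≤ B i j)
    (h : l2OpNorm B < 1) :
    ((1 - B) * (1 - B)⁻¹ = 1 ∧ (1 - B)⁻¹ * (1 - B) = 1) ∧ ∀ i j, 0 ≤ (1 - B)⁻¹ i j := by
  have hn : ‖B‖ < 1 := by
    rw [Matrix.l2_opNorm_def]
    exact h
  have hs : Summable (fun k : ℕ => B ^ k) := summable_geometric_of_norm_lt_one hn
  have h1 : (1 - B) * (∑' k : ℕ, B ^ k) = 1 := mul_neg_geom_series B hn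
  have hinv : (1 - B)⁻¹ = ∑' k : ℕ, B ^ k := Matrix.inv_eq_right_inv h1
  have h2 : (∑' k : ℕ, B ^ k) * (1 - B) = 1 := geom_series_mul_neg B hn
  rw [hinv]
  refine ⟨⟨h1, h2⟩, fun i j => ?_⟩
  have hpow : ∀ k : ℕ, ∀ i j, 0 ≤ (B ^ k) i j := by
    intro k
    induction k with
    | zero =>
      intro i j
      rw [pow_zero, Matrix.one_apply]
      split_ifs <;> norm_num
    | succ k ih =>
      intro i j
      rw [pow_succ, Matrix.mul_apply]
      exact Finset.sum_nonneg fun l _ => mul_nonneg (ih i l) (hB l j)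
  have hc : Continuous (Matrix.entryAddMonoidHom ℝ i j : Matrix (Fin m) (Fin m) ℝ →+ ℝ) :=
    continuous_id.matrix_elem i j
  have := hs.hasSum.map (Matrix.entryAddMonoidHom ℝ i j) hc
  exact this.nonneg fun k => hpow k i j

theorem reluM_of_nonneg {ι κ : Type*} (A : Matrix ι κ ℝ) (h : ∀ i j, 0 ≤ A i j) :
    reluM A = A := by
  ext i j
  exact max_eq_left (h i j)

/-- With nonnegative `Φ` and `A` and `γ‖A‖ < 1`, the matrix `Z = Φ·(I − γA)⁻¹` is
nonnegative, is the unique equilibrium point of the implicit-layer map, and the ReLU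
acts as the identity at this equilibrium. -/
theorem nonneg_explicit_equilibrium (n m : ℕ) (hn : 0 < n) (hm : 0 < m)
    (Φ : Matrix (Fin n) (Fin m) ℝ) (A : Matrix (Fin m) (Fin m) ℝ)
    (hΦ : ∀ i j, 0 ≤ Φ i j) (hA : ∀ i j, 0 ≤ A i j)
    (γ : ℝ) (hγ : 0 < γ) (hγ0 : γ * l2OpNorm A < 1) :
    (∀ i j, 0 ≤ (Φ * (1 - γ • A)⁻¹) i j) ∧
    reluM (γ • (Φ * (1 - γ • A)⁻¹ * A) + Φ) = Φ * (1 - γ • A)⁻¹ ∧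
    (∀ W : Matrix (Fin n) (Fin m) ℝ,
      reluM (γ • (W * A) + Φ) = W → W = Φ * (1 - γ • A)⁻¹) ∧
    reluM (γ • (Φ * (1 - γ • A)⁻¹ * A) + Φ) = γ • (Φ * (1 - γ • A)⁻¹ * A) + Φ := by
  have hB : ∀ i j, 0 ≤ (γ • A) i j := fun i j => mul_nonneg hγ.le (hA i j)
  have hnB : l2OpNorm (γ • A) < 1 := by
    have : l2OpNorm (γ • A) = γ * l2OpNorm A := by
      unfold l2OpNorm
      rw [map_smul, map_smul, norm_smul, Real.norm_of_nonneg hγ.le]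
    rwa [this]
  obtain ⟨⟨h1, h2⟩, h3⟩ := neumann_aux (γ • A) hB hnB
  have hstep : ∀ W : Matrix (Fin n) (Fin m) ℝ, (∀ i j, 0 ≤ W i j) →
      reluM (γ • (W * A) + Φ) = γ • (W * A) + Φ := by
    intro W hW
    apply reluM_of_nonneg
    intro i j
    refine add_nonneg (mul_nonneg hγ.le ?_) (hΦ i j)
    rw [Matrix.mul_apply]
    exact Finset.sum_nonneg fun l _ => mul_nonneg (hW i l) (hA l j)
  have hZ : ∀ i j, 0 ≤ (Φ * (1 - γ • A)⁻¹) i j := by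
    intro i j
    rw [Matrix.mul_apply]
    exact Finset.sum_nonneg fun l _ => mul_nonneg (hΦ i l) (h3 l j)
  refine ⟨hZ, ?_, ?_, hstep _ hZ⟩
  · rw [hstep _ hZ]
    have h4 : Φ * (1 - γ • A)⁻¹ * (1 - γ • A) = Φ := by
      rw [Matrix.mul_assoc, h2, Matrix.mul_one]
    rw [Matrix.mul_sub, Matrix.mul_one, Matrix.mul_smul] at h4
    exact (sub_eq_iff_eq_add'.mp h4).symm
  · intro W hW
    have hW0 : ∀ i j, 0 ≤ W i j := by
      intro i j
      rw [← hW]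
      exact le_max_right _ _
    rw [hstep W hW0] at hW
    have h4 : W * (1 - γ • A) = Φ := by
      rw [Matrix.mul_sub, Matrix.mul_one, Matrix.mul_smul]
      exact sub_eq_iff_eq_add'.mpr hW.symm
    rw [← h4, Matrix.mul_assoc, h1, Matrix.mul_one]
end

section
/- Let n be a positive integer, y ∈ ℝⁿ, λ₀ > 0, ε₁, K, R, C ≥ 0. Let u, û : [0, ∞) → ℝⁿ and k : [0, ∞) → ℝⁿ, k₀ ∈ ℝⁿ satisfy ‖k(t) − k₀‖ ≤ ε₁, ‖k₀‖ ≤ K, ‖y − u(t)‖ ≤ R·e^{−λ₀ t/2}, and ‖u(t) − û(t)‖ ≤ C·e^{−λ₀ t/2} for all t ≥ 0. Let F, G : [0, ∞) → ℝ be differentiable with F(0) = G(0), F'(t) = ⟨k(t), y − u(t)⟩ and G'(t) = ⟨k₀, y − û(t)⟩ for all t ≥ 0. Then |F(t) − G(t)| ≤ (2/λ₀)·(ε₁·R + K·C) for all t ≥ 0. -/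
open scoped InnerProductSpace

/-- Coupling of the test-point prediction `F` of the network (with time-varying kernel
vector `k(t)` and training prediction `u(t)`) with the linearized prediction `G`
(kernel vector `k₀`, training prediction `û(t)`): if `‖k(t) − k₀‖ ≤ ε₁`, `‖k₀‖ ≤ K`,
`‖y − u(t)‖ ≤ R e^{−λ₀t/2}` and `‖u(t) − û(t)‖ ≤ C e^{−λ₀t/2}`, then
`|F(t) − G(t)| ≤ (2/λ₀)(ε₁R + KC)`. -/
theorem coupling_prediction_functions (n : ℕ) (hn : 0 < n)
    (y : EuclideanSpace ℝ (Fin n)) (lam eps₁ K R C : ℝ)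
    (hlam : 0 < lam) (heps₁ : 0 ≤ eps₁) (hK : 0 ≤ K) (hR : 0 ≤ R) (hC : 0 ≤ C)
    (u uhat : ℝ → EuclideanSpace ℝ (Fin n))
    (k : ℝ → EuclideanSpace ℝ (Fin n)) (k₀ : EuclideanSpace ℝ (Fin n))
    (hk : ∀ t : ℝ, 0 ≤ t → ‖k t - k₀‖ ≤ eps₁)
    (hk₀ : ‖k₀‖ ≤ K)
    (hres : ∀ t : ℝ, 0 ≤ t → ‖y - u t‖ ≤ R * Real.exp (-(lam * t / 2)))
    (hclose : ∀ t : ℝ, 0 ≤ t → ‖u t - uhat t‖ ≤ C * Real.exp (-(lam * t / 2)))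
    (F G : ℝ → ℝ)
    (h0 : F 0 = G 0)
    (hF : ∀ t : ℝ, 0 ≤ t → HasDerivAt F (⟪k t, y - u t⟫_ℝ) t)
    (hG : ∀ t : ℝ, 0 ≤ t → HasDerivAt G (⟪k₀, y - uhat t⟫_ℝ) t) :
    ∀ t : ℝ, 0 ≤ t → |F t - G t| ≤ (2 / lam) * (eps₁ * R + K * C) := by
  intro t ht
  set M := eps₁ * R + K * C with hM
  have hM0 : 0 ≤ M := by positivity
  have hB : ∀ x : ℝ, HasDerivAt
      (fun s : ℝ => (2 / lam) * M * (1 - Real.exp (-(lam * s / 2))))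
      (M * Real.exp (-(lam * x / 2))) x := by
    intro x
    have h1 : HasDerivAt (fun s : ℝ => -(lam * s / 2)) (-(lam * 1 / 2)) x :=
      (((hasDerivAt_id x).const_mul lam).div_const 2).neg
    have h2 := ((h1.exp).const_sub 1).const_mul ((2 / lam) * M)
    have hl : lam ≠ 0 := hlam.ne'
    have e : (2 / lam) * M * -(Real.exp (-(lam * x / 2)) * -(lam * 1 / 2))
        = M * Real.exp (-(lam * x / 2)) := by
      generalize Real.exp (-(lam * x / 2)) = E
      field_simp
    rw [← e]
    exact h2
  have hD : ∀ x : ℝ, 0 ≤ x → HasDerivAt (fun s => F s - G s)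
      (⟪k x, y - u x⟫_ℝ - ⟪k₀, y - uhat x⟫_ℝ) x := fun x hx => (hF x hx).sub (hG x hx)
  have key := image_norm_le_of_norm_deriv_right_le_deriv_boundary
    (f := fun s => F s - G s) (a := 0) (b := t)
    (f' := fun x => ⟪k x, y - u x⟫_ℝ - ⟪k₀, y - uhat x⟫_ℝ)
    (fun x hx => (hD x hx.1).continuousAt.continuousWithinAt)
    (fun x hx => (hD x hx.1).hasDerivWithinAt) (by simp [h0]) hB
    (by
      intro x hx
      have hx0 : 0 ≤ x := hx.1
      have e : ⟪k x, y - u x⟫_ℝ - ⟪k₀, y - uhat x⟫_ℝ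
          = ⟪k x - k₀, y - u x⟫_ℝ - ⟪k₀, u x - uhat x⟫_ℝ := by
        simp only [inner_sub_left, inner_sub_right]
        ring
      have a1 : ‖⟪k x - k₀, y - u x⟫_ℝ‖ ≤ eps₁ * (R * Real.exp (-(lam * x / 2))) :=
        (norm_inner_le_norm _ _).trans
          (mul_le_mul (hk x hx0) (hres x hx0) (norm_nonneg _) heps₁)
      have a2 : ‖⟪k₀, u x - uhat x⟫_ℝ‖ ≤ K * (C * Real.exp (-(lam * x / 2))) :=
        (norm_inner_le_norm _ _).trans
          (mul_le_mul hk₀ (hclose x hx0) (norm_nonneg _) hK)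
      show ‖⟪k x, y - u x⟫_ℝ - ⟪k₀, y - uhat x⟫_ℝ‖ ≤ _
      rw [e]
      refine (norm_sub_le _ _).trans ((add_le_add a1 a2).trans (le_of_eq ?_))
      rw [hM]
      ring)
  have h := key (Set.right_mem_Icc.mpr ht)
  rw [Real.norm_eq_abs] at h
  refine h.trans (mul_le_of_le_one_right (by positivity) ?_)
  linarith [Real.exp_pos (-(lam * t / 2))]
end
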